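/- arXiv:2007.13170 — 2 statements merged into one kernel-verified Lean document; each statement's English description precedes it below -/
import Mathlib

section
/- Let H, H' be separable complex Hilbert spaces and suppose the operators B_0,…,B_m satisfy conditions (B1), (B2), (B4), each B_j is densely defined, and additionally B_j e_n ∈ D(B_j*) (the domain of the Hilbert-space adjoint of B_j) for every n ∈ M and every j = 0,…,m. Then D_B := ⋂_{j=0}^m D(B_j) = H_B; in particular, for every j and every x ∈ D(B_j) one has ∑_{n∈M} |x_n|² ‖B_j e_n‖²_{H'} ≤ ‖B_j x‖²_{H'} < ∞. -/
open scoped InnerProductSpace ENNReal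

/-- Pythagorean theorem for finite sums of pairwise orthogonal vectors. -/
theorem norm_sum_sq_of_pairwise_inner_eq_zero {𝕜 E ι : Type*} [RCLike 𝕜] [NormedAddCommGroup E]
    [InnerProductSpace 𝕜 E] {v : ι → E} (hv : ∀ i k, i ≠ k → ⟪v i, v k⟫_𝕜 = 0) (s : Finset ι) :
    ‖∑ i ∈ s, v i‖ ^ 2 = ∑ i ∈ s, ‖v i‖ ^ 2 := by
  classical
  induction s using Finset.induction_on with
  | empty => simp
  | insert a s ha ih =>
    rw [Finset.sum_insert ha, Finset.sum_insert ha, ← ih]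
    have h : ⟪v a, ∑ i ∈ s, v i⟫_𝕜 = 0 := by
      rw [inner_sum]
      exact Finset.sum_eq_zero fun i hi => hv a i fun h => ha (h ▸ hi)
    simpa only [sq] using norm_add_sq_eq_norm_sq_add_norm_sq_of_inner_eq_zero (𝕜 := 𝕜) _ _ h

/-- A series of pairwise orthogonal vectors with summable squared norms converges. -/
theorem summable_of_pairwise_inner_eq_zero {𝕜 E ι : Type*} [RCLike 𝕜] [NormedAddCommGroup E]
    [InnerProductSpace 𝕜 E] [CompleteSpace E] {v : ι → E}
    (hv : ∀ i k, i ≠ k → ⟪v i, v k⟫_𝕜 = 0) (h : Summable fun i => ‖v i‖ ^ 2) : Summable v := by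
  rw [summable_iff_vanishing_norm] at h ⊢
  intro ε hε
  obtain ⟨s, hs⟩ := h (ε ^ 2) (by positivity)
  refine ⟨s, fun t ht => ?_⟩
  have := lt_of_le_of_lt (Real.le_norm_self _) (hs t ht)
  rw [← norm_sum_sq_of_pairwise_inner_eq_zero hv] at this
  exact lt_of_pow_lt_pow_left₀ 2 hε.le this

namespace LinearPMap

variable {𝕜 E F ι : Type*} [RCLike 𝕜] [NormedAddCommGroup E] [InnerProductSpace 𝕜 E]
  [NormedAddCommGroup F] [InnerProductSpace 𝕜 F]
  {T : E →ₗ.[𝕜] F} {e : HilbertBasis ι 𝕜 E} {he : ∀ n, e n ∈ T.domain}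

/-- A closed operator with pairwise orthogonal values on a Hilbert basis is defined at every
vector whose weighted Fourier coefficients are square summable. -/
theorem IsClosed.mem_domain_of_summable [CompleteSpace F] (hT : T.IsClosed)
    (horth : ∀ n k, n ≠ k → ⟪T ⟨e n, he n⟩, T ⟨e k, he k⟩⟫_𝕜 = 0) {x : E}
    (hx : Summable fun n => ‖e.repr x n‖ ^ 2 * ‖T ⟨e n, he n⟩‖ ^ 2) : x ∈ T.domain := by
  have hs : Summable fun n => e.repr x n • T ⟨e n, he n⟩ := by
    refine summable_of_pairwise_inner_eq_zero (𝕜 := 𝕜) (fun n k hnk => ?_) ?_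
    · rw [inner_smul_left, inner_smul_right, horth n k hnk, mul_zero, mul_zero]
    · simpa only [norm_smul, mul_pow] using hx
  have hmem : (x, ∑' n, e.repr x n • T ⟨e n, he n⟩) ∈ T.graph := by
    refine IsClosed.mem_of_tendsto hT ((e.hasSum_repr x).prodMk hs.hasSum)
      (Filter.Eventually.of_forall fun s => ?_)
    rw [SetLike.mem_coe]
    refine Submodule.sum_mem _ fun n _ => ?_
    exact T.graph.smul_mem (e.repr x n) (T.mem_graph ⟨e n, he n⟩)
  exact T.mem_domain_of_mem_graph hmem

/-- If `T` has pairwise orthogonal values on a Hilbert basis, and these values lie in the domain of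
the adjoint, then `T† T` is diagonal in this basis. -/
theorem inner_apply_hilbertBasis [CompleteSpace E] (hd : Dense (T.domain : Set E))
    (horth : ∀ n k, n ≠ k → ⟪T ⟨e n, he n⟩, T ⟨e k, he k⟩⟫_𝕜 = 0)
    (hadj : ∀ n, T ⟨e n, he n⟩ ∈ T.adjointDomain) (x : T.domain) (n : ι) :
    ⟪T ⟨e n, he n⟩, T x⟫_𝕜 = (‖T ⟨e n, he n⟩‖ : 𝕜) ^ 2 * e.repr x n := by
  classical
  have hw (z : T.domain) : ⟪T† ⟨_, hadj n⟩, (z : E)⟫_𝕜 = ⟪T ⟨e n, he n⟩, T z⟫_𝕜 :=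
    adjoint_isFormalAdjoint hd ⟨_, hadj n⟩ z
  rw [← hw x, ← e.tsum_inner_mul_inner, tsum_eq_single n, ← e.repr_apply_apply]
  · rw [hw ⟨e n, he n⟩, inner_self_eq_norm_sq_to_K]
  · intro k hk
    rw [hw ⟨e k, he k⟩, horth n k hk.symm, zero_mul]

/-- Bessel's inequality for finite sums of the weighted Fourier coefficients. -/
theorem sum_sq_mul_sq_le [CompleteSpace E] (hd : Dense (T.domain : Set E))
    (horth : ∀ n k, n ≠ k → ⟪T ⟨e n, he n⟩, T ⟨e k, he k⟩⟫_𝕜 = 0)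
    (hadj : ∀ n, T ⟨e n, he n⟩ ∈ T.adjointDomain) (x : T.domain) (s : Finset ι) :
    ∑ n ∈ s, ‖e.repr x n‖ ^ 2 * ‖T ⟨e n, he n⟩‖ ^ 2 ≤ ‖T x‖ ^ 2 := by
  set y := ∑ n ∈ s, e.repr x n • T ⟨e n, he n⟩ with hy
  have hnorm : ‖y‖ ^ 2 = ∑ n ∈ s, ‖e.repr x n‖ ^ 2 * ‖T ⟨e n, he n⟩‖ ^ 2 := by
    rw [hy, norm_sum_sq_of_pairwise_inner_eq_zero (𝕜 := 𝕜)]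
    · simp only [norm_smul, mul_pow]
    · intro n k hnk
      rw [inner_smul_left, inner_smul_right, horth n k hnk, mul_zero, mul_zero]
  have hinner : ⟪y, T x⟫_𝕜 = ((‖y‖ ^ 2 : ℝ) : 𝕜) := by
    rw [hnorm, hy, sum_inner]
    push_cast
    refine Finset.sum_congr rfl fun n _ => ?_
    rw [inner_smul_left, inner_apply_hilbertBasis hd horth hadj, ← RCLike.conj_mul]
    ring
  have hle : ‖y‖ ^ 2 ≤ ‖y‖ * ‖T x‖ := by
    have := norm_inner_le_norm (𝕜 := 𝕜) y (T x)
    rwa [hinner, RCLike.norm_ofReal, abs_of_nonneg (by positivity)] at this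
  rw [← hnorm]
  nlinarith [sq_nonneg (‖y‖ - ‖T x‖)]

end LinearPMap

/-- Under conditions (B1), (B2), (B4), if moreover each `B_j` is densely
defined and `B_j e_n` belongs to the domain of the adjoint `B_j*` for every `n` and `j`, then
`D_B = H_B`: an element `x` lies in all the domains `D(B_j)` iff
`∑_n ‖x_n‖² ‖B_j e_n‖² < ∞` for each `j`; in particular, for every `j` and every
`x ∈ D(B_j)` the Bessel-type inequality `∑_n ‖x_n‖² ‖B_j e_n‖² ≤ ‖B_j x‖² < ∞` holds. -/
theorem statement1
    {H H' : Type*} [NormedAddCommGroup H] [InnerProductSpace ℂ H] [CompleteSpace H]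
    [NormedAddCommGroup H'] [InnerProductSpace ℂ H'] [CompleteSpace H']
    {ι : Type*} [Countable ι] (e : HilbertBasis ι ℂ H)
    (m : ℕ) (B : Fin (m + 1) → H →ₗ.[ℂ] H')
    (hB1 : ∀ j n, e n ∈ (B j).domain)
    (hB2 : ∀ (j) (n n' : ι), n ≠ n' →
      ⟪(B j) ⟨e n, hB1 j n⟩, (B j) ⟨e n', hB1 j n'⟩⟫_ℂ = 0)
    (hB4 : ∀ j, (B j).IsClosed)
    (hdense : ∀ j, Dense ((B j).domain : Set H))
    (hadj : ∀ j n, (B j) ⟨e n, hB1 j n⟩ ∈ (B j).adjointDomain) :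
    (∀ x : H, (∀ j, x ∈ (B j).domain) ↔
        (∀ j, Summable fun n => ‖e.repr x n‖ ^ 2 * ‖(B j) ⟨e n, hB1 j n⟩‖ ^ 2)) ∧
    (∀ (j) (x : H) (hxj : x ∈ (B j).domain),
        (Summable fun n => ‖e.repr x n‖ ^ 2 * ‖(B j) ⟨e n, hB1 j n⟩‖ ^ 2) ∧
        ∑' n, ‖e.repr x n‖ ^ 2 * ‖(B j) ⟨e n, hB1 j n⟩‖ ^ 2 ≤ ‖(B j) ⟨x, hxj⟩‖ ^ 2) := by
  have hsum (j) (x : H) (hxj : x ∈ (B j).domain) :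
      Summable fun n => ‖e.repr x n‖ ^ 2 * ‖(B j) ⟨e n, hB1 j n⟩‖ ^ 2 :=
    summable_of_sum_le (fun n => by positivity)
      ((B j).sum_sq_mul_sq_le (hdense j) (hB2 j) (hadj j) ⟨x, hxj⟩)
  refine ⟨fun x => ⟨fun hx j => hsum j x (hx j), fun hx j =>
    (hB4 j).mem_domain_of_summable (hB2 j) (hx j)⟩, fun j x hxj => ⟨hsum j x hxj, ?_⟩⟩
  exact (hsum j x hxj).tsum_le_of_sum_le
    ((B j).sum_sq_mul_sq_le (hdense j) (hB2 j) (hadj j) ⟨x, hxj⟩)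
end

section
/- Let X = H', suppose B_0,…,B_m satisfy (B1)–(B4), A : H → H' satisfies (A1) e_n ∈ D(A), (A2) A e_{n₀} ≠ 0 for some n₀, (A3) A is closable, and sup over f ∈ H' with ‖f‖_{H'} ≤ 1 of ∑~_{n∈M} |(f, A e_n)_{H'}|² / b_{n,1} is finite. Then for every h ∈ (0,∞)^{m+1} and every x ∈ D(A) ∩ H_B one has ‖Ax‖_{H'} ≤ ( sup_{‖f‖_{H'}≤1} ∑~_{n∈M} |(f, A e_n)_{H'}|² / b_{n,h} )^{1/2} · ‖x‖_{B,h}, and this inequality is sharp: the supremum of ‖Ax‖_{H'}/‖x‖_{B,h} over x ∈ D(A) ∩ H_B with ‖x‖_{B,h} ≠ 0 equals the constant on the right-hand side. -/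
open scoped InnerProductSpace ENNReal NNReal

section RegularizedSum

variable {H' ι : Type*} [NormedAddCommGroup H'] [InnerProductSpace ℂ H']

/-- The supremum over the unit ball of the regularized sums `∑~ |⟪f, a n⟫|² / b n`. -/
noncomputable def regularizedSup (a : ι → H') (b : ι → ℝ) : ℝ≥0∞ :=
  ⨆ (f : H') (_ : ‖f‖ ≤ 1), ∑' n, (‖⟪f, a n⟫_ℂ‖₊ : ℝ≥0∞) ^ 2 / ENNReal.ofReal (b n)

lemma tsum_le_regularizedSup (a : ι → H') (b : ι → ℝ) {f : H'} (hf : ‖f‖ ≤ 1) :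
    ∑' n, (‖⟪f, a n⟫_ℂ‖₊ : ℝ≥0∞) ^ 2 / ENNReal.ofReal (b n) ≤ regularizedSup a b :=
  le_iSup₂ (f := fun (f : H') (_ : ‖f‖ ≤ 1) ↦
    ∑' n, (‖⟪f, a n⟫_ℂ‖₊ : ℝ≥0∞) ^ 2 / ENNReal.ofReal (b n)) f hf

lemma regularizedSup_ne_top_of_mul_le {a : ι → H'} {b b' : ι → ℝ} {c : ℝ} (hc : 0 < c)
    (hb : ∀ n, c * b n ≤ b' n) (h : regularizedSup a b ≠ ⊤) : regularizedSup a b' ≠ ⊤ := by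
  have hc0 : ENNReal.ofReal c ≠ 0 := by simpa using hc
  refine ne_top_of_le_ne_top
    (ENNReal.mul_ne_top (ENNReal.inv_ne_top.2 hc0) h) (iSup₂_le fun f hf ↦ ?_)
  calc ∑' n, (‖⟪f, a n⟫_ℂ‖₊ : ℝ≥0∞) ^ 2 / ENNReal.ofReal (b' n)
      ≤ ∑' n, (ENNReal.ofReal c)⁻¹ *
          ((‖⟪f, a n⟫_ℂ‖₊ : ℝ≥0∞) ^ 2 / ENNReal.ofReal (b n)) := by
        refine ENNReal.tsum_le_tsum fun n ↦ ?_
        calc (‖⟪f, a n⟫_ℂ‖₊ : ℝ≥0∞) ^ 2 / ENNReal.ofReal (b' n)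
            ≤ (‖⟪f, a n⟫_ℂ‖₊ : ℝ≥0∞) ^ 2 / (ENNReal.ofReal c * ENNReal.ofReal (b n)) := by
              rw [← ENNReal.ofReal_mul hc.le]
              exact ENNReal.div_le_div_left (ENNReal.ofReal_le_ofReal (hb n)) _
          _ = _ := by
              rw [div_eq_mul_inv, div_eq_mul_inv,
                ENNReal.mul_inv (Or.inl hc0) (Or.inl ENNReal.ofReal_ne_top)]
              ring
    _ = (ENNReal.ofReal c)⁻¹ *
          ∑' n, (‖⟪f, a n⟫_ℂ‖₊ : ℝ≥0∞) ^ 2 / ENNReal.ofReal (b n) := ENNReal.tsum_mul_left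
    _ ≤ _ := by gcongr; exact tsum_le_regularizedSup a b hf

lemma inner_eq_zero_of_regularizedSup_ne_top {a : ι → H'} {b : ι → ℝ}
    (h : regularizedSup a b ≠ ⊤) {f : H'} (hf : ‖f‖ ≤ 1) {n : ι} (hn : b n = 0) :
    ⟪f, a n⟫_ℂ = 0 := by
  by_contra hne
  have h1 := ENNReal.ne_top_of_tsum_ne_top
    (ne_top_of_le_ne_top h (tsum_le_regularizedSup a b hf)) n
  apply h1
  rw [hn, ENNReal.ofReal_zero, ENNReal.div_zero]
  simpa using hne

lemma ofReal_sum_norm_inner_sq_div {a : ι → H'} {b : ι → ℝ} (hb : ∀ n, 0 ≤ b n)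
    (h : regularizedSup a b ≠ ⊤) {f : H'} (hf : ‖f‖ ≤ 1) (s : Finset ι) :
    ENNReal.ofReal (∑ n ∈ s, ‖⟪f, a n⟫_ℂ‖ ^ 2 / b n) =
      ∑ n ∈ s, (‖⟪f, a n⟫_ℂ‖₊ : ℝ≥0∞) ^ 2 / ENNReal.ofReal (b n) := by
  rw [ENNReal.ofReal_sum_of_nonneg fun n _ ↦ div_nonneg (sq_nonneg _) (hb n)]
  refine Finset.sum_congr rfl fun n _ ↦ ?_
  rcases (hb n).eq_or_lt with hn | hn
  · simp [inner_eq_zero_of_regularizedSup_ne_top h hf hn.symm]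
  · rw [ENNReal.ofReal_div_of_pos hn, ENNReal.ofReal_pow (norm_nonneg _),
      ofReal_norm, enorm_eq_nnnorm]

lemma sum_norm_inner_sq_div_le {a : ι → H'} {b : ι → ℝ} (hb : ∀ n, 0 ≤ b n)
    (h : regularizedSup a b ≠ ⊤) {f : H'} (hf : ‖f‖ ≤ 1) (s : Finset ι) :
    ∑ n ∈ s, ‖⟪f, a n⟫_ℂ‖ ^ 2 / b n ≤ (regularizedSup a b).toReal := by
  rw [← ENNReal.ofReal_le_iff_le_toReal h, ofReal_sum_norm_inner_sq_div hb h hf]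
  exact (ENNReal.sum_le_tsum s).trans (tsum_le_regularizedSup a b hf)

lemma norm_sum_smul_le {a : ι → H'} {b : ι → ℝ} (hb : ∀ n, 0 ≤ b n)
    (h : regularizedSup a b ≠ ⊤) (x : ι → ℂ) (s : Finset ι) :
    ‖∑ n ∈ s, x n • a n‖ ≤
      √(regularizedSup a b).toReal * √(∑ n ∈ s, ‖x n‖ ^ 2 * b n) := by
  set y := ∑ n ∈ s, x n • a n with hy
  rcases eq_or_ne y 0 with h0 | h0
  · rw [h0, norm_zero]; positivity
  have hy0 : ‖y‖ ≠ 0 := norm_ne_zero_iff.2 h0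
  set f : H' := ((‖y‖⁻¹ : ℝ) : ℂ) • y with hfdef
  have hf : ‖f‖ ≤ 1 := by
    rw [hfdef, norm_smul, Complex.norm_real, norm_inv, norm_norm, inv_mul_cancel₀ hy0]
  have hfy : ‖⟪f, y⟫_ℂ‖ = ‖y‖ := by
    rw [hfdef, inner_smul_left, inner_self_eq_norm_sq_to_K]
    simp
    field_simp
  rw [mul_comm]
  calc ‖y‖ = ‖∑ n ∈ s, x n * ⟪f, a n⟫_ℂ‖ := by
        rw [← hfy]
        conv_lhs => rw [hy, inner_sum]
        simp_rw [inner_smul_right]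
    _ ≤ ∑ n ∈ s, ‖x n * ⟪f, a n⟫_ℂ‖ := norm_sum_le _ _
    _ = ∑ n ∈ s, (‖x n‖ * √(b n)) * (‖⟪f, a n⟫_ℂ‖ / √(b n)) := by
        refine Finset.sum_congr rfl fun n _ ↦ ?_
        rw [norm_mul]
        rcases (hb n).eq_or_lt with hn | hn
        · simp [inner_eq_zero_of_regularizedSup_ne_top h hf hn.symm]
        · have := (Real.sqrt_pos.2 hn).ne'
          field_simp
    _ ≤ √(∑ n ∈ s, (‖x n‖ * √(b n)) ^ 2) * √(∑ n ∈ s, (‖⟪f, a n⟫_ℂ‖ / √(b n)) ^ 2) :=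
        Real.sum_mul_le_sqrt_mul_sqrt _ _ _
    _ ≤ _ := by
        simp_rw [mul_pow, div_pow, Real.sq_sqrt (hb _)]
        gcongr
        exact sum_norm_inner_sq_div_le hb h hf s

lemma summable_smul_of_regularizedSup_ne_top [CompleteSpace H'] {a : ι → H'} {b : ι → ℝ}
    (hb : ∀ n, 0 ≤ b n) (h : regularizedSup a b ≠ ⊤) {x : ι → ℂ}
    (hx : Summable fun n ↦ ‖x n‖ ^ 2 * b n) : Summable fun n ↦ x n • a n := by
  rw [summable_iff_vanishing_norm]
  intro ε hε
  set C := √(regularizedSup a b).toReal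
  have hC : 0 ≤ C := Real.sqrt_nonneg _
  obtain ⟨s, hs⟩ := summable_iff_vanishing_norm.1 hx ((ε / (C + 1)) ^ 2) (by positivity)
  refine ⟨s, fun t ht ↦ ?_⟩
  have h1 : √(∑ n ∈ t, ‖x n‖ ^ 2 * b n) < ε / (C + 1) := by
    rw [Real.sqrt_lt' (by positivity)]
    exact (Real.le_norm_self _).trans_lt (hs t ht)
  calc ‖∑ n ∈ t, x n • a n‖ ≤ C * √(∑ n ∈ t, ‖x n‖ ^ 2 * b n) := norm_sum_smul_le hb h x t
    _ ≤ C * (ε / (C + 1)) := by gcongr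
    _ < (C + 1) * (ε / (C + 1)) := by gcongr; linarith
    _ = ε := by field_simp

lemma norm_le_of_hasSum_smul {a : ι → H'} {b : ι → ℝ}
    (hb : ∀ n, 0 ≤ b n) (h : regularizedSup a b ≠ ⊤) {x : ι → ℂ}
    (hx : Summable fun n ↦ ‖x n‖ ^ 2 * b n) {y : H'} (hy : HasSum (fun n ↦ x n • a n) y) :
    ‖y‖ ≤ √(regularizedSup a b).toReal * √(∑' n, ‖x n‖ ^ 2 * b n) := by
  refine le_of_tendsto hy.norm (Filter.Eventually.of_forall fun s ↦ ?_)
  refine (norm_sum_smul_le hb h x s).trans ?_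
  gcongr
  exact hx.sum_le_tsum s fun n _ ↦ mul_nonneg (sq_nonneg _) (hb n)

/-- A constant bounding all the ratios `‖∑ x n • a n‖ / √(∑ |x n|² b n)` of finite combinations
bounds the regularized supremum. -/
lemma regularizedSup_le_of_forall_sum {a : ι → H'} {b : ι → ℝ} (hb : ∀ n, 0 ≤ b n)
    (h : regularizedSup a b ≠ ⊤) {C : ℝ} (hC : 0 ≤ C)
    (hle : ∀ (x : ι → ℂ) (s : Finset ι), 0 < ∑ n ∈ s, ‖x n‖ ^ 2 * b n →
      ‖∑ n ∈ s, x n • a n‖ ≤ C * √(∑ n ∈ s, ‖x n‖ ^ 2 * b n)) :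
    √(regularizedSup a b).toReal ≤ C := by
  rw [Real.sqrt_le_left hC]
  refine ENNReal.toReal_le_of_le_ofReal (sq_nonneg C) (iSup₂_le fun f hf ↦ ?_)
  rw [ENNReal.tsum_eq_iSup_sum]
  refine iSup_le fun s ↦ ?_
  rw [← ofReal_sum_norm_inner_sq_div hb h hf]
  refine ENNReal.ofReal_le_ofReal ?_
  set T := ∑ n ∈ s, ‖⟪f, a n⟫_ℂ‖ ^ 2 / b n with hT
  have hT0 : 0 ≤ T := Finset.sum_nonneg fun n _ ↦ div_nonneg (sq_nonneg _) (hb n)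
  rcases hT0.eq_or_lt with hz | hpos
  · rw [← hz]; positivity
  let x : ι → ℂ := fun n ↦ (starRingEnd ℂ) ⟪f, a n⟫_ℂ / (b n : ℂ)
  have hxT : ∑ n ∈ s, ‖x n‖ ^ 2 * b n = T := by
    refine Finset.sum_congr rfl fun n _ ↦ ?_
    simp only [x, norm_div, RCLike.norm_conj, Complex.norm_real, div_pow, Real.norm_eq_abs, sq_abs]
    rcases (hb n).eq_or_lt with hn | hn
    · simp [← hn]
    · field_simp
  have hfT : ⟪f, ∑ n ∈ s, x n • a n⟫_ℂ = (T : ℂ) := by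
    rw [inner_sum, hT]
    push_cast
    refine Finset.sum_congr rfl fun n _ ↦ ?_
    rw [inner_smul_right, div_mul_eq_mul_div, Complex.conj_mul']
  have h1 : T ≤ C * √T := by
    calc T = ‖⟪f, ∑ n ∈ s, x n • a n⟫_ℂ‖ := by
          rw [hfT, Complex.norm_real, Real.norm_of_nonneg hT0]
      _ ≤ ‖f‖ * ‖∑ n ∈ s, x n • a n‖ := norm_inner_le_norm _ _
      _ ≤ ‖∑ n ∈ s, x n • a n‖ := mul_le_of_le_one_left (norm_nonneg _) hf
      _ ≤ C * √T := by
          have := hle x s (by rwa [hxT])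
          rwa [hxT] at this
  have h2 : √T ≤ C := by
    have h3 : √T * √T ≤ C * √T := by rwa [Real.mul_self_sqrt hT0]
    exact le_of_mul_le_mul_right h3 (Real.sqrt_pos.2 hpos)
  exact (Real.sqrt_le_left hC).1 h2

end RegularizedSum

/-- A closable operator may be applied termwise to a convergent series in its domain
whose image series converges. -/
lemma LinearPMap.IsClosable.hasSum_apply {𝕜 E F ι : Type*} [NormedField 𝕜]
    [NormedAddCommGroup E] [NormedSpace 𝕜 E] [NormedAddCommGroup F] [NormedSpace 𝕜 F]
    {A : E →ₗ.[𝕜] F} (hA : A.IsClosable) {u : ι → A.domain} {x : A.domain}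
    (hx : HasSum (fun i ↦ (u i : E)) x) (hu : Summable fun i ↦ A (u i)) :
    HasSum (fun i ↦ A (u i)) (A x) := by
  obtain ⟨A', hA'⟩ := hA
  obtain ⟨y, hy⟩ := hu
  have hmem : ((x : E), y) ∈ A'.graph := by
    rw [← hA']
    refine mem_closure_of_tendsto (hx.prodMk hy) (Filter.Eventually.of_forall fun s ↦ ?_)
    exact A.graph.sum_mem fun i _ ↦ A.mem_graph (u i)
  have hmem' : ((x : E), A x) ∈ A'.graph := by
    rw [← hA']
    exact A.graph.le_topologicalClosure (A.mem_graph x)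
  rwa [← A'.mem_graph_snd_inj hmem hmem' rfl]

lemma HilbertBasis.repr_sum_smul {𝕜 E ι : Type*} [RCLike 𝕜] [NormedAddCommGroup E]
    [InnerProductSpace 𝕜 E] (e : HilbertBasis ι 𝕜 E) (x : ι → 𝕜) (s : Finset ι) (n : ι)
    [Decidable (n ∈ s)] :
    e.repr (∑ i ∈ s, x i • e i) n = if n ∈ s then x n else 0 := by
  classical
  rw [e.repr_apply_apply, inner_sum]
  simp [inner_smul_right, orthonormal_iff_ite.1 e.orthonormal]

/-- mean-squared Hardy–Littlewood–Pólya-type inequality and its sharpness.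
Let `X = H'`, let `B_0,…,B_m` satisfy (B1)–(B4) and `A : H → H'` satisfy (A1) (`e_n ∈ D(A)`),
(A2) (`A e_{n₀} ≠ 0` for some `n₀`), (A3) (`A` closable), and suppose
`sup_{‖f‖ ≤ 1} ∑~_n |(f, A e_n)|²/b_{n,1} < ∞` (regularized sums computed in `ℝ≥0∞`).
Then for every positive weight vector `h` and `x ∈ D(A) ∩ H_B`,
`‖Ax‖ ≤ (sup_{‖f‖≤1} ∑~_n |(f,Ae_n)|²/b_{n,h})^{1/2} ‖x‖_{B,h}`, and this constant is sharp:
the supremum of `‖Ax‖/‖x‖_{B,h}` over admissible `x` equals it. -/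
theorem statement7
    {H H' : Type*} [NormedAddCommGroup H] [InnerProductSpace ℂ H] [CompleteSpace H]
    [NormedAddCommGroup H'] [InnerProductSpace ℂ H'] [CompleteSpace H']
    {ι : Type*} [Countable ι] (e : HilbertBasis ι ℂ H)
    (m : ℕ) (B : Fin (m + 1) → H →ₗ.[ℂ] H')
    (hB1 : ∀ j n, e n ∈ (B j).domain)
    (hB2 : ∀ (j) (n n' : ι), n ≠ n' →
      ⟪(B j) ⟨e n, hB1 j n⟩, (B j) ⟨e n', hB1 j n'⟩⟫_ℂ = 0)
    (hB3 : ∃ j n, (B j) ⟨e n, hB1 j n⟩ ≠ 0)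
    (hB4 : ∀ j, (B j).IsClosed)
    (A : H →ₗ.[ℂ] H')
    (hA1 : ∀ n, e n ∈ A.domain)
    (hA2 : ∃ n, A ⟨e n, hA1 n⟩ ≠ 0)
    (hA3 : A.IsClosable)
    (hsum : (⨆ (f : H') (_ : ‖f‖ ≤ 1),
        ∑' n, (‖⟪f, A ⟨e n, hA1 n⟩⟫_ℂ‖₊ : ℝ≥0∞) ^ 2 /
          ENNReal.ofReal (∑ j, ‖(B j) ⟨e n, hB1 j n⟩‖ ^ 2)) ≠ ⊤) :
    ∀ (h : Fin (m + 1) → ℝ), (∀ j, 0 < h j) →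
      (∀ (x : H) (hxA : x ∈ A.domain),
        (∀ j, Summable fun n => ‖e.repr x n‖ ^ 2 * ‖(B j) ⟨e n, hB1 j n⟩‖ ^ 2) →
        ‖A ⟨x, hxA⟩‖ ≤
          Real.sqrt (⨆ (f : H') (_ : ‖f‖ ≤ 1),
              ∑' n, (‖⟪f, A ⟨e n, hA1 n⟩⟫_ℂ‖₊ : ℝ≥0∞) ^ 2 /
                ENNReal.ofReal (∑ j, h j * ‖(B j) ⟨e n, hB1 j n⟩‖ ^ 2)).toReal *
          Real.sqrt (∑' n, ‖e.repr x n‖ ^ 2 *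
              (∑ j, h j * ‖(B j) ⟨e n, hB1 j n⟩‖ ^ 2))) ∧
      sSup {r : ℝ | ∃ (x : H) (hxA : x ∈ A.domain),
          (∀ j, Summable fun n => ‖e.repr x n‖ ^ 2 * ‖(B j) ⟨e n, hB1 j n⟩‖ ^ 2) ∧
          (∑' n, ‖e.repr x n‖ ^ 2 * (∑ j, h j * ‖(B j) ⟨e n, hB1 j n⟩‖ ^ 2)) ≠ 0 ∧
          r = ‖A ⟨x, hxA⟩‖ /
            Real.sqrt (∑' n, ‖e.repr x n‖ ^ 2 * (∑ j, h j * ‖(B j) ⟨e n, hB1 j n⟩‖ ^ 2))}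
        = Real.sqrt (⨆ (f : H') (_ : ‖f‖ ≤ 1),
            ∑' n, (‖⟪f, A ⟨e n, hA1 n⟩⟫_ℂ‖₊ : ℝ≥0∞) ^ 2 /
              ENNReal.ofReal (∑ j, h j * ‖(B j) ⟨e n, hB1 j n⟩‖ ^ 2)).toReal := by
  classical
  intro h hh
  set a : ι → H' := fun n ↦ A ⟨e n, hA1 n⟩ with ha
  set b : ι → ℝ := fun n ↦ ∑ j, h j * ‖(B j) ⟨e n, hB1 j n⟩‖ ^ 2 with hbdef
  have hb : ∀ n, 0 ≤ b n := fun n ↦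
    Finset.sum_nonneg fun j _ ↦ mul_nonneg (hh j).le (sq_nonneg _)
  have hfin : regularizedSup a b ≠ ⊤ := by
    obtain ⟨j₀, hj₀⟩ := Finite.exists_min h
    refine regularizedSup_ne_top_of_mul_le (hh j₀) (fun n ↦ ?_) hsum
    rw [Finset.mul_sum]
    exact Finset.sum_le_sum fun j _ ↦ mul_le_mul_of_nonneg_right (hj₀ j) (sq_nonneg _)
  have hle : ∀ (x : H) (hxA : x ∈ A.domain),
      (∀ j, Summable fun n ↦ ‖e.repr x n‖ ^ 2 * ‖(B j) ⟨e n, hB1 j n⟩‖ ^ 2) →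
      ‖A ⟨x, hxA⟩‖ ≤ √(regularizedSup a b).toReal * √(∑' n, ‖e.repr x n‖ ^ 2 * b n) := by
    intro x hxA hxB
    have hs : Summable fun n ↦ ‖e.repr x n‖ ^ 2 * b n := by
      have : Summable fun n ↦ ∑ j, h j * (‖e.repr x n‖ ^ 2 * ‖(B j) ⟨e n, hB1 j n⟩‖ ^ 2) :=
        summable_sum fun j _ ↦ (hxB j).mul_left (h j)
      refine this.congr fun n ↦ ?_
      rw [hbdef, Finset.mul_sum]
      exact Finset.sum_congr rfl fun j _ ↦ by ring
    have hmap : ∀ n, A (e.repr x n • ⟨e n, hA1 n⟩) = e.repr x n • a n := fun n ↦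
      A.map_smul _ _
    have hsum' := hA3.hasSum_apply (u := fun n ↦ e.repr x n • (⟨e n, hA1 n⟩ : A.domain))
      (x := ⟨x, hxA⟩) (e.hasSum_repr x) (by
        simp_rw [hmap]
        exact summable_smul_of_regularizedSup_ne_top hb hfin hs)
    simp_rw [hmap] at hsum'
    exact norm_le_of_hasSum_smul hb hfin hs hsum'
  refine ⟨hle, le_antisymm (Real.sSup_le ?_ (Real.sqrt_nonneg _)) ?_⟩
  · rintro r ⟨x, hxA, hxB, -, rfl⟩
    exact div_le_of_le_mul₀ (Real.sqrt_nonneg _) (Real.sqrt_nonneg _) (hle x hxA hxB)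
  · refine regularizedSup_le_of_forall_sum hb hfin (Real.sSup_nonneg ?_) fun x s hpos ↦ ?_
    · rintro r ⟨x, hxA, -, -, rfl⟩
      positivity
    · have hmem : ∑ n ∈ s, x n • e n ∈ A.domain :=
        A.domain.sum_mem fun n _ ↦ A.domain.smul_mem _ (hA1 n)
      have hA : A ⟨∑ n ∈ s, x n • e n, hmem⟩ = ∑ n ∈ s, x n • a n := by
        have : (⟨∑ n ∈ s, x n • e n, hmem⟩ : A.domain) = ∑ n ∈ s, x n • ⟨e n, hA1 n⟩ := by
          ext; simp
        rw [this]
        exact (map_sum A.toFun _ _).trans (Finset.sum_congr rfl fun n _ ↦ A.map_smul _ _)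
      have hoff : ∀ n ∉ s, e.repr (∑ i ∈ s, x i • e i) n = 0 := fun n hn ↦ by
        rw [e.repr_sum_smul, if_neg hn]
      have hnorm : ∑' n, ‖e.repr (∑ i ∈ s, x i • e i) n‖ ^ 2 * b n =
          ∑ n ∈ s, ‖x n‖ ^ 2 * b n := by
        rw [tsum_eq_sum (s := s) fun n hn ↦ by rw [hoff n hn]; simp]
        exact Finset.sum_congr rfl fun n hn ↦ by rw [e.repr_sum_smul, if_pos hn]
      rw [← div_le_iff₀ (Real.sqrt_pos.2 hpos)]
      refine le_csSup ⟨√(regularizedSup a b).toReal, ?_⟩ ⟨_, hmem, fun j ↦ ?_, ?_, ?_⟩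
      · rintro r ⟨x, hxA, hxB, -, rfl⟩
        exact div_le_of_le_mul₀ (Real.sqrt_nonneg _) (Real.sqrt_nonneg _) (hle x hxA hxB)
      · exact summable_of_ne_finset_zero (s := s) fun n hn ↦ by
          rw [hoff n hn]; simp
      · exact hnorm.trans_ne hpos.ne'
      · rw [hA]
        exact congrArg _ (congrArg _ hnorm.symm)
end
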